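/- Let d, s ∈ ℕ and Λ = s·ℤ^d. Then there exists a constant N(d,s) > 0, depending only on d and s, such that every bounded polyhedron P ∈ 𝒫_ifm(s,d) (an integral Λ-free polytope, inclusion-maximal among integral Λ-free polyhedra) satisfies |P ∩ Λ| ≤ N(d,s). -/

import Mathlib

open Set

/-- The set of integer points `ℤ^d` inside `ℝ^d`. -/
def intPts (d : ℕ) : Set (Fin d → ℝ) := {x | ∀ i, ∃ z : ℤ, x i = (z : ℝ)}

/-- The lattice `Λ = s·ℤ^d` inside `ℝ^d`. -/
def sLat (d s : ℕ) : Set (Fin d → ℝ) := {x | ∀ i, ∃ z : ℤ, x i = (s : ℝ) * (z : ℝ)}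

/-- A polyhedron: a finite intersection of closed halfspaces. -/
def IsPolyhedron {d : ℕ} (P : Set (Fin d → ℝ)) : Prop :=
  ∃ (n : ℕ) (A : Fin n → Fin d → ℝ) (b : Fin n → ℝ),
    P = {x | ∀ i, (∑ j, A i j * x j) ≤ b i}

/-- An integral set: it equals the convex hull of its integer points. -/
def IsIntegralPoly {d : ℕ} (P : Set (Fin d → ℝ)) : Prop :=
  P = convexHull ℝ (P ∩ intPts d)

/-- The affine map `x ↦ U·x + t` with integer matrix `U` and translation `t : ℝ^d`. -/
noncomputable def affMap {d : ℕ} (U : Matrix (Fin d) (Fin d) ℤ) (t : Fin d → ℝ)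
    (x : Fin d → ℝ) : Fin d → ℝ := fun i => (∑ j, (U i j : ℝ) * x j) + t i

/-- An integral `Λ`-free polyhedron, where `Λ = s·ℤ^d`. -/
def IsIntLatFree (d s : ℕ) (P : Set (Fin d → ℝ)) : Prop :=
  IsPolyhedron P ∧ IsIntegralPoly P ∧ interior P ∩ sLat d s = ∅

/-- Membership in `𝒫_ifm(s,d)`: an integral `Λ`-free polyhedron which is
inclusion-maximal among integral `Λ`-free polyhedra. -/
def MemPifm (d s : ℕ) (P : Set (Fin d → ℝ)) : Prop :=
  IsIntLatFree d s P ∧ ∀ Q : Set (Fin d → ℝ), IsIntLatFree d s Q → P ⊆ Q → P = Q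

open Filter Topology in
theorem exists_nat_mul_near_int {ι : Type*} [Fintype ι] (x : ι → ℝ) {ε : ℝ} (hε : 0 < ε) :
    ∃ k : ℕ, 0 < k ∧ ∃ m : ι → ℤ, ∀ i, |(k : ℝ) * x i - m i| < ε := by
  obtain ⟨M, hM⟩ := exists_nat_gt (1 / ε)
  have hM0 : (0 : ℝ) < M := lt_trans (by positivity) hM
  let f : ℕ → ι → Fin (M + 1) := fun k i =>
    ⟨⌊Int.fract ((k : ℝ) * x i) * M⌋₊, by
      have h1 := Int.fract_lt_one ((k : ℝ) * x i)
      have : ⌊Int.fract ((k : ℝ) * x i) * M⌋₊ ≤ M :=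
        Nat.floor_le_of_le (by nlinarith)
      omega⟩
  have key : ∀ a b : ℕ, a < b → f a = f b →
      ∃ k : ℕ, 0 < k ∧ ∃ m : ι → ℤ, ∀ i, |(k : ℝ) * x i - m i| < ε := by
    intro a b hab h
    refine ⟨b - a, by omega, fun i => ⌊(b : ℝ) * x i⌋ - ⌊(a : ℝ) * x i⌋, fun i => ?_⟩
    have hi : ⌊Int.fract ((a : ℝ) * x i) * M⌋₊ = ⌊Int.fract ((b : ℝ) * x i) * M⌋₊ := by
      simpa [f] using congrArg Fin.val (congrFun h i)
    have ha := Int.fract_nonneg ((a : ℝ) * x i)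
    have hb := Int.fract_nonneg ((b : ℝ) * x i)
    have a1 := Nat.floor_le (mul_nonneg ha hM0.le)
    have a2 := Nat.lt_floor_add_one (Int.fract ((a : ℝ) * x i) * M)
    have b1 := Nat.floor_le (mul_nonneg hb hM0.le)
    have b2 := Nat.lt_floor_add_one (Int.fract ((b : ℝ) * x i) * M)
    rw [hi] at a1 a2
    have hεM : 1 < ε * M := by
      rwa [div_lt_iff₀ hε, mul_comm] at hM
    have e : ((b - a : ℕ) : ℝ) * x i - ((⌊(b : ℝ) * x i⌋ - ⌊(a : ℝ) * x i⌋ : ℤ) : ℝ)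
        = Int.fract ((b : ℝ) * x i) - Int.fract ((a : ℝ) * x i) := by
      rw [Nat.cast_sub hab.le]
      push_cast
      rw [Int.fract, Int.fract]
      ring
    rw [e, abs_lt]
    constructor
    · refine lt_of_mul_lt_mul_right ?_ hM0.le
      linarith
    · refine lt_of_mul_lt_mul_right ?_ hM0.le
      linarith
  obtain ⟨a, b, hne, h⟩ := Finite.exists_ne_map_eq_of_infinite f
  rcases lt_or_gt_of_ne hne with hab | hab
  · exact key a b hab h
  · exact key b a hab h.symm

/-- An integer dilation of the barycentric coordinates `l`, followed by an integer translation by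
multiples of `s`, that dilates the coordinate `i₀` and keeps at least half of each coordinate. -/
def HasDilation {ι : Type*} [Fintype ι] (s : ℕ) (i₀ : ι) (l : ι → ℝ) : Prop :=
  ∃ k : ℕ, 0 < k ∧ ∃ m : ι → ℤ, (∑ i, (s : ℝ) * m i) = k ∧ m i₀ = 0 ∧
    ∀ i, -(l i / 2) ≤ k * l i - s * m i

open Filter Topology in
theorem eventually_hasDilation {ι : Type*} [Fintype ι] {s : ℕ} (hs : 1 ≤ s) {i₀ : ι}
    {l : ι → ℝ} (hl : l ∈ stdSimplex ℝ ι) (h0 : l i₀ = 0) :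
    ∀ᶠ l' in 𝓝 l, (∀ i, 0 ≤ l' i) → HasDilation s i₀ l' := by
  have hs0 : (0 : ℝ) < s := by exact_mod_cast hs
  have hsmall : ∀ a : ℝ, Tendsto (fun ε : ℝ => a * ε) (𝓝[>] 0) (𝓝 0) := fun a =>
    ((continuous_const_mul a).tendsto' 0 0 (mul_zero a)).mono_left nhdsWithin_le_nhds
  have hex : ∀ᶠ ε : ℝ in 𝓝[>] 0, 0 < ε ∧ (∀ i, 0 < l i → s * ε < l i / 2) ∧
      (Fintype.card ι : ℝ) * ε < 1 := by
    refine (eventually_mem_nhdsWithin.mono fun x hx => hx).and (Filter.Eventually.and ?_ ?_)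
    · refine eventually_all.2 fun i => ?_
      by_cases hi : 0 < l i
      · filter_upwards [(hsmall s).eventually_lt_const (half_pos hi)] with ε hε _ using hε
      · exact Eventually.of_forall fun _ h => absurd h hi
    · exact (hsmall _).eventually_lt_const one_pos
  obtain ⟨ε, hε, hε1, hε2⟩ := hex.exists
  obtain ⟨k, hk, m, hm⟩ := exists_nat_mul_near_int l hε
  classical
  let m' : ι → ℤ := fun i => if l i = 0 then 0 else m i
  have hm' : ∀ i, |(k : ℝ) * l i - m' i| < ε := by
    intro i
    by_cases hi : l i = 0
    · simp [m', hi, hε]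
    · simpa [m', hi] using hm i
  have hsum : (k : ℤ) = ∑ i, m' i := by
    have h1 : |((k - ∑ i, m' i : ℤ) : ℝ)| < 1 := by
      have : ((k - ∑ i, m' i : ℤ) : ℝ) = ∑ i, ((k : ℝ) * l i - m' i) := by
        rw [Finset.sum_sub_distrib, ← Finset.mul_sum, hl.2]
        push_cast
        ring
      rw [this]
      refine lt_of_le_of_lt (Finset.abs_sum_le_sum_abs _ _) (lt_of_le_of_lt ?_ hε2)
      refine (Finset.sum_le_sum fun i _ => (hm' i).le).trans ?_
      simp
    have h2 : |(k - ∑ i, m' i : ℤ)| < 1 := by exact_mod_cast h1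
    rw [Int.abs_lt_one_iff] at h2
    omega
  have hnear : ∀ i, 0 < l i →
      ∀ᶠ l' in 𝓝 l, -(l' i / 2) < ((s * k : ℕ) : ℝ) * l' i - s * m' i := by
    intro i hi
    have hc : Continuous fun l' : ι → ℝ => -(l' i / 2) := by fun_prop
    have hc' : Continuous fun l' : ι → ℝ => ((s * k : ℕ) : ℝ) * l' i - s * m' i := by fun_prop
    refine hc.continuousAt.eventually_lt hc'.continuousAt ?_
    have h1 := (abs_lt.1 (hm' i)).1
    have h2 := hε1 i hi
    push_cast
    nlinarith
  have hall := eventually_all.2 fun i => eventually_imp_distrib_left.2 (hnear i)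
  filter_upwards [hall] with l' hl' hpos
  refine ⟨s * k, by positivity, m', ?_, by simp [m', h0], fun i => ?_⟩
  · rw [← Finset.mul_sum]
    have : (k : ℝ) = ∑ i, (m' i : ℝ) := by exact_mod_cast hsum
    rw [← this]
    push_cast
    ring
  · rcases (hl.1 i).lt_or_eq with hi | hi
    · exact (hl' i hi).le
    · have : m' i = 0 := by simp [m', ← hi]
      rw [this]
      have h1 := hpos i
      have : 0 ≤ ((s * k : ℕ) : ℝ) * l' i := by positivity
      simp only [Int.cast_zero, mul_zero, sub_zero]
      linarith

open Filter Topology in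
theorem exists_forall_hasDilation {ι : Type*} [Fintype ι] {s : ℕ} (hs : 1 ≤ s) (i₀ : ι) :
    ∃ c : ℝ, 0 < c ∧ ∀ l ∈ stdSimplex ℝ ι, l i₀ < c → HasDilation s i₀ l := by
  by_contra! hcon
  choose l hl hlt hbad using fun j : ℕ => hcon (1 / ((j : ℝ) + 1)) (by positivity)
  obtain ⟨a, ha, φ, hφ, hlim⟩ := (isCompact_stdSimplex ℝ ι).tendsto_subseq hl
  have hlim₀ : Tendsto (fun j => l (φ j) i₀) atTop (𝓝 (a i₀)) :=
    ((continuous_apply i₀).tendsto a).comp hlim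
  have ha0 : a i₀ = 0 := by
    refine tendsto_nhds_unique hlim₀ (squeeze_zero (fun j => (hl _).1 i₀) (fun j => (hlt _).le) ?_)
    exact tendsto_one_div_add_atTop_nhds_zero_nat.comp hφ.tendsto_atTop
  obtain ⟨j, hj⟩ := (hlim.eventually (eventually_hasDilation hs ha ha0)).exists
  exact hbad _ (hj (hl _).1)

theorem exists_forall_card_le_hasDilation {s : ℕ} (hs : 1 ≤ s) (N : ℕ) :
    ∃ c : ℝ, 0 < c ∧ ∀ n ≤ N, ∀ l ∈ stdSimplex ℝ (Option (Fin n)), l none < c →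
      HasDilation s none l := by
  induction N with
  | zero =>
    obtain ⟨c, hc, h⟩ := exists_forall_hasDilation hs (none : Option (Fin 0))
    refine ⟨c, hc, fun n hn => ?_⟩
    obtain rfl := Nat.le_zero.1 hn
    exact h
  | succ N ih =>
    obtain ⟨c, hc, h⟩ := ih
    obtain ⟨c', hc', h'⟩ := exists_forall_hasDilation hs (none : Option (Fin (N + 1)))
    refine ⟨min c c', lt_min hc hc', fun n hn l hl hlt => ?_⟩
    rcases Nat.le_succ_iff.1 hn with hn | rfl
    · exact h n hn l hl (hlt.trans_le (min_le_left _ _))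
    · exact h' l hl (hlt.trans_le (min_le_right _ _))

theorem zero_mem_sLat (d s : ℕ) : (0 : Fin d → ℝ) ∈ sLat d s := fun _ => ⟨0, by simp⟩

theorem sLat_add {d s : ℕ} {x y : Fin d → ℝ} (hx : x ∈ sLat d s) (hy : y ∈ sLat d s) :
    x + y ∈ sLat d s := by
  intro i
  obtain ⟨a, ha⟩ := hx i
  obtain ⟨b, hb⟩ := hy i
  exact ⟨a + b, by rw [Pi.add_apply, ha, hb]; push_cast; ring⟩

theorem sLat_zsmul {d s : ℕ} {x : Fin d → ℝ} (hx : x ∈ sLat d s) (n : ℤ) :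
    (n : ℝ) • x ∈ sLat d s := by
  intro i
  obtain ⟨a, ha⟩ := hx i
  exact ⟨n * a, by rw [Pi.smul_apply, ha, smul_eq_mul]; push_cast; ring⟩

theorem sLat_smul_intPts {d s : ℕ} {x : Fin d → ℝ} (hx : x ∈ intPts d) (n : ℤ) :
    ((s : ℝ) * n) • x ∈ sLat d s := by
  intro i
  obtain ⟨a, ha⟩ := hx i
  exact ⟨n * a, by rw [Pi.smul_apply, ha, smul_eq_mul]; push_cast; ring⟩

theorem sLat_sum {d s : ℕ} {ι : Type*} (t : Finset ι) (f : ι → Fin d → ℝ)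
    (h : ∀ i ∈ t, f i ∈ sLat d s) : ∑ i ∈ t, f i ∈ sLat d s := by
  induction t using Finset.cons_induction with
  | empty => simpa using zero_mem_sLat d s
  | cons a t _ ih =>
    rw [Finset.sum_cons]
    exact sLat_add (h a (by simp)) (ih fun i hi => h i (by simp [hi]))

theorem intPts_add_zsmul {d s : ℕ} {v u : Fin d → ℝ} (hv : v ∈ intPts d) (hu : u ∈ sLat d s)
    (n : ℤ) : v + (n : ℝ) • u ∈ intPts d := by
  intro i
  obtain ⟨a, ha⟩ := hv i
  obtain ⟨b, hb⟩ := hu i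
  exact ⟨a + n * (s * b), by rw [Pi.add_apply, Pi.smul_apply, ha, hb, smul_eq_mul]; push_cast; ring⟩

theorem sLat_subset_intPts (d s : ℕ) : sLat d s ⊆ intPts d := by
  intro x hx i
  obtain ⟨a, ha⟩ := hx i
  exact ⟨s * a, by rw [ha]; push_cast; ring⟩

/-- The Minkowski sum of `P` with the line spanned by `u`. -/
def cylinder {E : Type*} [AddCommGroup E] [Module ℝ E] (P : Set E) (u : E) : Set E :=
  {w | ∃ r : ℝ, w + r • u ∈ P}

section Cylinder

variable {E : Type*} [AddCommGroup E] [Module ℝ E] {P : Set E} {u : E}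

theorem subset_cylinder : P ⊆ cylinder P u := fun x hx => ⟨0, by simpa using hx⟩

theorem add_smul_mem_cylinder {p : E} (hp : p ∈ P) (r : ℝ) : p + r • u ∈ cylinder P u :=
  ⟨-r, by simpa [add_assoc] using hp⟩

theorem Convex.cylinder (hP : Convex ℝ P) : Convex ℝ (cylinder P u) := by
  rintro x ⟨r, hx⟩ y ⟨t, hy⟩ a b ha hb hab
  refine ⟨a * r + b * t, ?_⟩
  convert hP hx hy ha hb hab using 1
  module

end Cylinder

theorem exists_forall_le_and_forall_ge {ι κ : Type*} [Finite ι] [Finite κ] {f : ι → ℝ} {g : κ → ℝ}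
    (h : ∀ i j, f i ≤ g j) : ∃ r, (∀ i, f i ≤ r) ∧ ∀ j, r ≤ g j := by
  cases isEmpty_or_nonempty ι
  · cases isEmpty_or_nonempty κ
    · exact ⟨0, isEmptyElim, isEmptyElim⟩
    · obtain ⟨j, hj⟩ := Finite.exists_min g
      exact ⟨g j, isEmptyElim, hj⟩
  · obtain ⟨i, hi⟩ := Finite.exists_max f
    exact ⟨f i, hi, h i⟩

theorem isPolyhedron_of_fintype {d : ℕ} {ι : Type*} [Fintype ι] {P : Set (Fin d → ℝ)}
    (A : ι → Fin d → ℝ) (b : ι → ℝ) (h : P = {x | ∀ i, A i ⬝ᵥ x ≤ b i}) : IsPolyhedron P := by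
  refine ⟨Fintype.card ι, A ∘ (Fintype.equivFin ι).symm, b ∘ (Fintype.equivFin ι).symm, ?_⟩
  rw [h]
  ext x
  exact ((Fintype.equivFin ι).symm.forall_congr_left
    (p := fun i => (A ∘ (Fintype.equivFin ι).symm) i ⬝ᵥ x ≤ (b ∘ (Fintype.equivFin ι).symm) i)
    |>.trans (by simp)).symm

theorem IsPolyhedron.convex {d : ℕ} {P : Set (Fin d → ℝ)} (hP : IsPolyhedron P) : Convex ℝ P := by
  obtain ⟨n, A, b, rfl⟩ := hP
  intro x hx y hy s t hs ht hst i
  have hx' : A i ⬝ᵥ x ≤ b i := hx i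
  have hy' : A i ⬝ᵥ y ≤ b i := hy i
  change A i ⬝ᵥ (s • x + t • y) ≤ b i
  rw [dotProduct_add, dotProduct_smul, dotProduct_smul, smul_eq_mul, smul_eq_mul]
  calc s * (A i ⬝ᵥ x) + t * (A i ⬝ᵥ y) ≤ s * b i + t * b i := by gcongr
    _ = b i := by rw [← add_mul, hst, one_mul]

/-- Fourier–Motzkin elimination of the coordinate along `u`. -/
theorem IsPolyhedron.cylinder {d : ℕ} {P : Set (Fin d → ℝ)} (hP : IsPolyhedron P)
    (u : Fin d → ℝ) : IsPolyhedron (cylinder P u) := by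
  classical
  obtain ⟨n, A, b, rfl⟩ := hP
  let a : Fin n → ℝ := fun i => A i ⬝ᵥ u
  refine isPolyhedron_of_fintype (ι := {i // a i = 0} ⊕ {i // 0 < a i} × {i // a i < 0})
    (Sum.elim (fun i => A i) fun p => a p.1 • A p.2 - a p.2 • A p.1)
    (Sum.elim (fun i => b i) fun p => a p.1 * b p.2 - a p.2 * b p.1) ?_
  ext w
  have hmem : ∀ r : ℝ, (w + r • u ∈ {x | ∀ i, (∑ j, A i j * x j) ≤ b i}) ↔
      ∀ i, A i ⬝ᵥ w + r * a i ≤ b i := fun r => by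
    have : ∀ i, A i ⬝ᵥ (w + r • u) = A i ⬝ᵥ w + r * a i := fun i => by
      rw [dotProduct_add, dotProduct_smul, smul_eq_mul]
    simp only [← this]
    rfl
  refine (exists_congr hmem).trans ?_
  simp only [mem_ofPred_eq, Sum.forall, Sum.elim_inl, Sum.elim_inr, Prod.forall, Subtype.forall,
    sub_dotProduct, smul_dotProduct, smul_eq_mul]
  constructor
  · rintro ⟨r, hr⟩
    refine ⟨fun i hi => by simpa [hi] using hr i, fun i hi j hj => ?_⟩
    nlinarith [mul_le_mul_of_nonneg_left (hr j) hi.le, mul_le_mul_of_nonpos_left (hr i) hj.le]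
  · rintro ⟨h0, h⟩
    obtain ⟨r, hr1, hr2⟩ := exists_forall_le_and_forall_ge
      (f := fun j : {i // a i < 0} => (b j - A j ⬝ᵥ w) / a j)
      (g := fun i : {i // 0 < a i} => (b i - A i ⬝ᵥ w) / a i) (by
        rintro ⟨j, hj⟩ ⟨i, hi⟩
        simp only
        rw [le_div_iff₀ hi, div_mul_eq_mul_div, div_le_iff_of_neg hj]
        have := h i hi j hj
        linarith)
    refine ⟨r, fun i => ?_⟩
    rcases lt_trichotomy (a i) 0 with hi | hi | hi
    · have := hr1 ⟨i, hi⟩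
      simp only [div_le_iff_of_neg hi] at this
      linarith
    · simpa [hi] using h0 i hi
    · have := hr2 ⟨i, hi⟩
      simp only [le_div_iff₀ hi] at this
      linarith

theorem IsIntegralPoly.cylinder {d s : ℕ} {P : Set (Fin d → ℝ)} (hP : IsIntegralPoly P)
    {u : Fin d → ℝ} (hu : u ∈ sLat d s) : IsIntegralPoly (cylinder P u) := by
  have hconv : Convex ℝ P := by
    rw [hP]
    exact convex_convexHull ℝ _
  refine Subset.antisymm ?_ (convexHull_min inter_subset_left hconv.cylinder)
  rintro w ⟨r, hr⟩
  set C := convexHull ℝ (_root_.cylinder P u ∩ intPts d)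
  have hC : Convex ℝ C := convex_convexHull ℝ _
  have hsub : P ⊆ {p | p + (-r) • u ∈ C} := by
    rw [hP]
    refine convexHull_min (fun v hv => ?_) ?_
    · have hz : ∀ n : ℤ, v + (n : ℝ) • u ∈ C := fun n =>
        subset_convexHull ℝ _ ⟨add_smul_mem_cylinder hv.1 _, intPts_add_zsmul hv.2 hu n⟩
      have h1 := Int.fract_nonneg (-r)
      have h2 := (Int.fract_lt_one (-r)).le
      have h3 := hC (hz ⌊-r⌋) (hz (⌊-r⌋ + 1)) (sub_nonneg.2 h2) h1 (by ring)
      have e : -r = ⌊-r⌋ + Int.fract (-r) := (Int.floor_add_fract _).symm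
      show v + (-r) • u ∈ C
      convert h3 using 1
      rw [e]
      simp only [Int.floor_intCast_add, Int.floor_fract, Int.fract_intCast_add, Int.fract_fract]
      push_cast
      module
    · intro x hx y hy a b ha hb hab
      have := hC hx hy ha hb hab
      show a • x + b • y + (-r) • u ∈ C
      convert this using 1
      obtain rfl : b = 1 - a := by linarith
      module
  have := hsub hr
  simpa [add_assoc] using this

section Interior

variable {E : Type*} [NormedAddCommGroup E] [NormedSpace ℝ E]

theorem exists_mem_add_smul_sub_of_mem_interior {C : Set E} {z : E} (hz : z ∈ interior C) (x : E) :
    ∃ ε : ℝ, 0 < ε ∧ z + ε • (z - x) ∈ C := by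
  have hc : Continuous fun ε : ℝ => z + ε • (z - x) := by fun_prop
  have hev : ∀ᶠ ε : ℝ in nhds 0, z + ε • (z - x) ∈ C :=
    hc.continuousAt.eventually_mem (by simpa using mem_interior_iff_mem_nhds.1 hz)
  obtain ⟨ε, hε, hpos⟩ := ((hev.filter_mono nhdsWithin_le_nhds).and
    (eventually_mem_nhdsWithin (a := (0 : ℝ)) (s := Ioi 0))).exists
  exact ⟨ε, hpos, hε⟩

theorem affineSpan_eq_top_of_interior_cylinder {P : Set E} {x u : E} {κ : ℝ} (hκ : κ ≠ 0)
    (hx : x ∈ P) (hy : x + κ • u ∈ P) (h : (interior (cylinder P u)).Nonempty) :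
    affineSpan ℝ P = ⊤ := by
  have hu : u ∈ (affineSpan ℝ P).direction := by
    have := AffineSubspace.vsub_mem_direction (subset_affineSpan ℝ P hy)
      (subset_affineSpan ℝ P hx)
    rw [vsub_eq_sub, add_sub_cancel_left] at this
    exact ((affineSpan ℝ P).direction.smul_mem_iff hκ).1 this
  have hsub : cylinder P u ⊆ affineSpan ℝ P := by
    rintro w ⟨r, hr⟩
    have := AffineSubspace.vadd_mem_of_mem_direction
      ((affineSpan ℝ P).direction.smul_mem (-r) hu) (subset_affineSpan ℝ P hr)
    simpa [vadd_eq_add] using this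
  rw [eq_top_iff, ← isOpen_interior.affineSpan_eq_top h]
  exact affineSpan_le.2 (interior_subset.trans hsub)

theorem exists_add_smul_mem_interior [FiniteDimensional ℝ E] {P : Set E} (hP : Convex ℝ P)
    {x u : E} {κ : ℝ} (hκ : κ ≠ 0) (hx : x ∈ P) (hy : x + κ • u ∈ P) {z : E}
    (hz : z ∈ interior (cylinder P u)) : ∃ t : ℝ, z + t • u ∈ interior P := by
  obtain ⟨w, hw⟩ := hP.interior_nonempty_iff_affineSpan_eq_top.2
    (affineSpan_eq_top_of_interior_cylinder hκ hx hy ⟨z, hz⟩)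
  obtain ⟨ε, hε, r, hr⟩ := exists_mem_add_smul_sub_of_mem_interior hz w
  have h1 : 0 < 1 + ε := by positivity
  have := hP.combo_interior_self_mem_interior hw hr (a := ε / (1 + ε)) (b := 1 / (1 + ε))
    (by positivity) (by positivity) (by field_simp; ring)
  refine ⟨r / (1 + ε), ?_⟩
  convert this using 1
  have e : z = (1 / (1 + ε)) • ((1 + ε) • z) := by
    rw [smul_smul, one_div, inv_mul_cancel₀ h1.ne', one_smul]
  nth_rw 1 [e]
  module

theorem exists_int_add_smul_mem_interior {P : Set E} (hP : Convex ℝ P) {z u : E} {a b t : ℝ}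
    (hab : 1 < b - a) (ha : z + a • u ∈ P) (hb : z + b • u ∈ P) (ht : z + t • u ∈ interior P) :
    ∃ j : ℤ, z + (j : ℝ) • u ∈ interior P := by
  have key : ∀ e j : ℝ, z + e • u ∈ P → e ≠ t → 0 < (j - e) / (t - e) → (j - e) / (t - e) ≤ 1 →
      z + j • u ∈ interior P := by
    intro e j he hne h0 h1
    have := hP.add_smul_sub_mem_interior he ht ⟨h0, h1⟩
    convert this using 1
    have hte : t - e ≠ 0 := sub_ne_zero.2 hne.symm
    have : j = e + (j - e) / (t - e) * (t - e) := by field_simp; ring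
    nth_rw 1 [this]
    module
  have h1 := Int.floor_le a
  have h2 := Int.lt_floor_add_one a
  refine ⟨⌊a⌋ + 1, ?_⟩
  push_cast
  rcases le_or_gt ((⌊a⌋ : ℝ) + 1) t with h | h
  · have hat : 0 < t - a := by linarith
    refine key a _ ha (by linarith) (div_pos (by linarith) hat) ?_
    rw [div_le_one hat]
    linarith
  · have hbt : t - b < 0 := by linarith
    refine key b _ hb (by linarith) (div_pos_of_neg_of_neg (by linarith) hbt) ?_
    rw [div_le_one_of_neg hbt]
    linarith

end Interior

section Lattice

variable {d s : ℕ} {P : Set (Fin d → ℝ)} {u : Fin d → ℝ} {ι : Type*} [Fintype ι]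
  {p : ι → Fin d → ℝ}

theorem exists_double_coordinate (hP : Convex ℝ P) (hp : ∀ i, p i ∈ P ∩ intPts d) {i₀ : ι}
    {l : ι → ℝ} (hl : l ∈ stdSimplex ℝ ι) (hd : HasDilation s i₀ l) {r : ℝ}
    (hz : (∑ i, l i • p i) + r • u ∈ interior (cylinder P u) ∩ sLat d s) :
    ∃ l' ∈ stdSimplex ℝ ι, ∃ r' : ℝ,
      (∑ i, l' i • p i) + r' • u ∈ interior (cylinder P u) ∩ sLat d s ∧
      2 * l i₀ ≤ l' i₀ := by
  obtain ⟨k, hk, m, hsum, hm₀, hm⟩ := hd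
  have hk1 : (1 : ℝ) ≤ k := by exact_mod_cast hk
  let l' : ι → ℝ := fun i => (k + 1) * l i - s * m i
  have hl' : ∀ i, 0 ≤ 2 * l' i - l i := fun i => by
    have := hm i
    simp only [l']
    linarith
  have hl'1 : ∑ i, l' i = 1 := by
    simp only [l', Finset.sum_sub_distrib, ← Finset.mul_sum, hl.2]
    rw [← Finset.mul_sum] at hsum
    rw [hsum]
    ring
  refine ⟨l', ⟨fun i => ?_, hl'1⟩, (k + 1) * r, ⟨?_, ?_⟩, ?_⟩
  · have := hl' i
    have := hl.1 i
    linarith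
  · have hw : ∑ i, (2 * l' i - l i) • p i ∈ P := by
      refine hP.sum_mem (fun i _ => hl' i) ?_ fun i _ => (hp i).1
      rw [Finset.sum_sub_distrib, ← Finset.mul_sum, hl'1, hl.2]
      norm_num
    have := hP.cylinder.combo_interior_self_mem_interior hz.1
      (add_smul_mem_cylinder (u := u) hw (2 * ((k + 1) * r) - r)) (a := 1 / 2) (b := 1 / 2)
      (by norm_num) (by norm_num) (by norm_num)
    convert this using 1
    simp only [sub_smul, mul_smul, Finset.sum_sub_distrib, ← Finset.smul_sum]
    module
  · have h1 : ∑ i, ((s : ℝ) * (-m i : ℤ)) • p i ∈ sLat d s :=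
      sLat_sum _ _ fun i _ => sLat_smul_intPts (hp i).2 _
    have := sLat_add (sLat_zsmul hz.2 (k + 1)) h1
    convert this using 1
    simp only [l', sub_smul, mul_smul, Finset.sum_sub_distrib, ← Finset.smul_sum, Int.cast_neg,
      neg_smul, smul_neg, Finset.sum_neg_distrib]
    push_cast
    module
  · simp only [l', hm₀, Int.cast_zero, mul_zero, sub_zero]
    exact mul_le_mul_of_nonneg_right (by linarith) (hl.1 _)

theorem exists_le_coordinate (hP : Convex ℝ P) (hp : ∀ i, p i ∈ P ∩ intPts d) {i₀ : ι}
    {c : ℝ} (hc : ∀ l ∈ stdSimplex ℝ ι, l i₀ < c → HasDilation s i₀ l)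
    {l : ι → ℝ} (hl : l ∈ stdSimplex ℝ ι) (hl₀ : 0 < l i₀) {r : ℝ}
    (hz : (∑ i, l i • p i) + r • u ∈ interior (cylinder P u) ∩ sLat d s) :
    ∃ l' ∈ stdSimplex ℝ ι, ∃ r' : ℝ,
      (∑ i, l' i • p i) + r' • u ∈ interior (cylinder P u) ∩ sLat d s ∧ c ≤ l' i₀ := by
  by_contra! hcon
  have hgrow : ∀ N : ℕ, ∃ l' ∈ stdSimplex ℝ ι, ∃ r' : ℝ,
      (∑ i, l' i • p i) + r' • u ∈ interior (cylinder P u) ∩ sLat d s ∧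
      2 ^ N * l i₀ ≤ l' i₀ := by
    intro N
    induction N with
    | zero => exact ⟨l, hl, r, hz, by simp⟩
    | succ N ih =>
      obtain ⟨l₁, h₁, r₁, hz₁, hle⟩ := ih
      obtain ⟨l₂, h₂, r₂, hz₂, hle'⟩ :=
        exists_double_coordinate hP hp h₁ (hc l₁ h₁ (hcon l₁ h₁ r₁ hz₁)) hz₁
      exact ⟨l₂, h₂, r₂, hz₂, by rw [pow_succ]; linarith⟩
  obtain ⟨N, hN⟩ := pow_unbounded_of_one_lt (c / l i₀) (one_lt_two (α := ℝ))
  obtain ⟨l', hl', r', hz', hle⟩ := hgrow N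
  have h1 := hcon l' hl' r' hz'
  rw [div_lt_iff₀ hl₀] at hN
  linarith

/-- If `P` contains a lattice segment along `u` that is long compared to `1 / c`, then a lattice
point in the interior of the cylinder over `P` yields one in the interior of `P`. -/
theorem interior_cylinder_inter_sLat_eq_empty (hP : IsIntLatFree d s P) {c κ : ℝ}
    (hc : ∀ n ≤ d + 1, ∀ l ∈ stdSimplex ℝ (Option (Fin n)), l none < c → HasDilation s none l)
    (hκ : 0 < κ) (hcκ : 1 < c * κ) (hu : u ∈ sLat d s) {x : Fin d → ℝ} (hx : x ∈ P ∩ sLat d s)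
    (hy : x + κ • u ∈ P) : interior (cylinder P u) ∩ sLat d s = ∅ := by
  by_contra! hne
  obtain ⟨z, hz, hzL⟩ := hne
  have hconv := hP.1.convex
  obtain ⟨ε, hε, r, hr⟩ := exists_mem_add_smul_sub_of_mem_interior hz x
  have h1 : 0 < 1 + ε := by positivity
  rw [hP.2.1] at hr
  obtain ⟨ι, hι, v, w, hv, hind, hw, hw1, hsum⟩ := eq_pos_convex_span_of_mem_convexHull hr
  have hcard : Fintype.card ι ≤ d + 1 := by
    refine hind.card_le_finrank_succ.trans ?_
    have := Submodule.finrank_le (vectorSpan ℝ (range v))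
    simp only [Module.finrank_fin_fun] at this
    omega
  let e := Fintype.equivFin ι
  let p : Option (Fin (Fintype.card ι)) → Fin d → ℝ := fun o => o.elim x fun i => v (e.symm i)
  let l : Option (Fin (Fintype.card ι)) → ℝ := fun o =>
    o.elim (ε / (1 + ε)) fun i => (1 / (1 + ε)) * w (e.symm i)
  have hp : ∀ o, p o ∈ P ∩ intPts d := by
    rintro (_ | i)
    · exact ⟨hx.1, sLat_subset_intPts d s hx.2⟩
    · exact hv (mem_range_self _)
  have hl : l ∈ stdSimplex ℝ _ := by
    refine ⟨?_, ?_⟩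
    · rintro (_ | i)
      · simp only [l, Option.elim]; positivity
      · have := hw (e.symm i)
        simp only [l, Option.elim]; positivity
    · rw [Fintype.sum_option]
      simp only [l, Option.elim]
      rw [← Finset.mul_sum, Equiv.sum_comp e.symm w, hw1]
      field_simp
      ring
  have hlz : (∑ o, l o • p o) + (-(r / (1 + ε))) • u = z := by
    rw [Fintype.sum_option]
    simp only [l, p, Option.elim, mul_smul]
    rw [← Finset.smul_sum, Equiv.sum_comp e.symm fun i => w i • v i, hsum]
    have e : z = (1 / (1 + ε)) • ((1 + ε) • z) := by
      rw [smul_smul, one_div, inv_mul_cancel₀ h1.ne', one_smul]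
    nth_rw 3 [e]
    module
  obtain ⟨l', hl', r', ⟨hz', hzL'⟩, hcl⟩ := exists_le_coordinate hconv hp (u := u)
    (hc _ hcard) hl (show 0 < ε / (1 + ε) by positivity) (r := -(r / (1 + ε)))
    (by rw [hlz]; exact ⟨hz, hzL⟩)
  set z' := (∑ i, l' i • p i) + r' • u with hzdef
  obtain ⟨t, ht⟩ := exists_add_smul_mem_interior hconv hκ.ne' hx.1 hy hz'
  have ha : z' + (-r') • u ∈ P := by
    have := hconv.sum_mem (fun i _ => hl'.1 i) hl'.2 fun i _ => (hp i).1
    simpa [hzdef, add_assoc] using this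
  have hb : z' + (-r' + l' none * κ) • u ∈ P := by
    let p' : Option (Fin (Fintype.card ι)) → Fin d → ℝ := fun o => o.elim (x + κ • u) (p ∘ some)
    have hp' : ∀ o, p' o ∈ P := by
      rintro (_ | i)
      · exact hy
      · exact (hp (some i)).1
    have := hconv.sum_mem (fun i _ => hl'.1 i) hl'.2 fun i _ => hp' i
    convert this using 1
    rw [hzdef, Fintype.sum_option, Fintype.sum_option]
    simp only [p, p', Option.elim, Function.comp]
    module
  obtain ⟨j, hj⟩ := exists_int_add_smul_mem_interior hconv
    (by nlinarith [mul_le_mul_of_nonneg_right hcl hκ.le]) ha hb ht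
  exact (Set.eq_empty_iff_forall_notMem.1 hP.2.2) _ ⟨hj, sLat_add hzL' (sLat_zsmul hu j)⟩

end Lattice

theorem cylinder_ne_of_isBounded {E : Type*} [NormedAddCommGroup E] [NormedSpace ℝ E] {P : Set E}
    (hP : Bornology.IsBounded P) (hne : P.Nonempty) {u : E} (hu : u ≠ 0) : P ≠ cylinder P u := by
  intro h
  obtain ⟨x, hx⟩ := hne
  obtain ⟨R, hR⟩ := hP.exists_norm_le
  have hu' : 0 < ‖u‖ := norm_pos_iff.2 hu
  have hR0 := (norm_nonneg x).trans (hR x hx)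
  have h1 : ‖x + ((2 * R + 1) / ‖u‖) • u‖ ≤ R := hR _ (by rw [h]; exact add_smul_mem_cylinder hx _)
  have h2 := norm_le_add_norm_add (((2 * R + 1) / ‖u‖) • u) x
  rw [norm_smul, Real.norm_of_nonneg (by positivity), div_mul_cancel₀ _ hu'.ne'] at h2
  have h3 := hR x hx
  rw [add_comm] at h1
  linarith

/-- The number of points of `Λ = s·ℤ^d` in a bounded element of `𝒫_ifm(s,d)` is bounded
by a constant depending only on `d` and `s`. -/
theorem Pifm_lattice_point_bound (d s : ℕ) (hs : 1 ≤ s) :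
    ∃ N : ℕ, 0 < N ∧
      ∀ P : Set (Fin d → ℝ), MemPifm d s P → Bornology.IsBounded P →
        (P ∩ sLat d s).Finite ∧ (P ∩ sLat d s).ncard ≤ N := by
  obtain ⟨c, hc, hdil⟩ := exists_forall_card_le_hasDilation hs (d + 1)
  obtain ⟨K, hK⟩ := exists_nat_gt (1 / c)
  have hK0 : (0 : ℝ) < K := lt_trans (by positivity) hK
  have : NeZero K := ⟨by rintro rfl; simp at hK0⟩
  have hs0 : (s : ℝ) ≠ 0 := by positivity
  refine ⟨Nat.card (Fin d → ZMod K), Nat.card_pos, fun P hP hbdd => ?_⟩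
  have hround : ∀ x ∈ sLat d s, ∀ i, x i = s * (round (x i / s) : ℝ) := by
    intro x hx i
    obtain ⟨a, ha⟩ := hx i
    rw [ha, mul_div_cancel_left₀ _ hs0, round_intCast]
  let f : (Fin d → ℝ) → Fin d → ZMod K := fun x i => (round (x i / s) : ℤ)
  have hinj : InjOn f (P ∩ sLat d s) := by
    intro x hx y hy hxy
    by_contra hne
    have hdvd : ∀ i, ∃ q : ℤ, round (y i / s) - round (x i / s) = K * q := fun i =>
      (ZMod.intCast_eq_intCast_iff_dvd_sub _ _ _).1 (congrFun hxy i)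
    choose q hq using hdvd
    let u : Fin d → ℝ := fun i => s * q i
    have hu : u ∈ sLat d s := fun i => ⟨q i, rfl⟩
    have hyx : x + (K : ℝ) • u = y := by
      ext i
      have : ((round (y i / s) : ℝ)) = round (x i / s) + K * q i := by
        have := hq i
        have h : round (y i / s) = round (x i / s) + K * q i := by omega
        exact_mod_cast h
      rw [Pi.add_apply, Pi.smul_apply, smul_eq_mul, hround x hx.2 i, hround y hy.2 i, this]
      simp only [u]
      ring
    have hu0 : u ≠ 0 := by
      intro h
      rw [h, smul_zero, add_zero] at hyx
      exact hne hyx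
    have hfree := interior_cylinder_inter_sLat_eq_empty hP.1 hdil hK0
      (by rwa [div_lt_iff₀ hc, mul_comm] at hK) hu hx (by rw [hyx]; exact hy.1)
    exact cylinder_ne_of_isBounded hbdd ⟨x, hx.1⟩ hu0
      (hP.2 _ ⟨hP.1.1.cylinder u, hP.1.2.1.cylinder hu, hfree⟩ subset_cylinder)
  refine ⟨Set.Finite.of_injOn (mapsTo_univ f _) hinj finite_univ, ?_⟩
  rw [← Set.ncard_univ]
  exact Set.ncard_le_ncard_of_injOn f (fun _ _ => mem_univ _) hinj
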